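/- arXiv:2001.10240 — 6 statements merged into one kernel-verified Lean document; each statement's English description precedes it below -/
import Mathlib

section
/- Consider the consensus game defined below, and let (C^e_[1],…,C^e_[M]) be a profile with J_i^consensus = 0 for every i ∈ Fin M (i.e., w_{ij} |δ_{ij}(C^e_[i]) − δ_{ij}(C^e_[j])| = 0 for all i and all j ∈ M_i). Then no coarsening deviation can decrease the potential: for every i and every opinion C that C^e_[i] refines (C^e_[i] ⪯ C), one has φ(C^e_[1],…,C,…,C^e_[M]) ≥ φ(C^e_[1],…,C^e_[M]), where C is placed in the i-th coordinate. (Coarsening case in the proof of Theorem 4.) -/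
open Finset

namespace ConsensusGame

/-- `delta C i j` is `0` if the partition (equivalence relation) `C` relates `i` and `j`,
and `1` otherwise. -/
noncomputable def delta {M : ℕ} (C : Setoid (Fin M)) (i j : Fin M) : ℝ :=
  open Classical in if C.r i j then 0 else 1

/-- Subsystem `i`'s objective `J_i = J_i^consensus + ρ·J_i^power` at the profile `P`. -/
noncomputable def Jcost {M : ℕ} (Mi : Fin M → Finset (Fin M)) (w σ : Fin M → Fin M → ℝ)
    (ρ ε : ℝ) (i : Fin M) (P : Fin M → Setoid (Fin M)) : ℝ :=
  (∑ j ∈ Mi i, w i j * |delta (P i) i j - delta (P j) i j|)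
    + ρ * ∑ j ∈ Mi i, (w i j + ε) * σ i j * (1 - delta (P i) i j)

/-- The potential function `φ(C_[1],…,C_[M]) = (1/2) Σ_i J_i`. -/
noncomputable def potential {M : ℕ} (Mi : Fin M → Finset (Fin M)) (w σ : Fin M → Fin M → ℝ)
    (ρ ε : ℝ) (P : Fin M → Setoid (Fin M)) : ℝ :=
  (1 / 2) * ∑ i : Fin M, Jcost Mi w σ ρ ε i P

/-- `D` refines `C` (written `D ⪯ C`): whenever `D` relates `i` and `j`, so does `C`. -/
def Refines {M : ℕ} (D C : Setoid (Fin M)) : Prop :=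
  ∀ i j : Fin M, D.r i j → C.r i j

theorem delta_le_of_refines {M : ℕ} {D C : Setoid (Fin M)} (h : Refines D C) (i j : Fin M) :
    delta C i j ≤ delta D i j := by
  unfold delta
  by_cases hD : D.r i j
  · rw [if_pos hD, if_pos (h i j hD)]
  · rw [if_neg hD]
    split_ifs <;> norm_num

/-- If subsystem `k` has zero consensus cost at `P`, then its objective does not decrease when
its own opinion is coarsened, whatever the other subsystems do. -/
theorem Jcost_le_Jcost_of_refines {M : ℕ} {Mi : Fin M → Finset (Fin M)}
    {w σ : Fin M → Fin M → ℝ} {ρ ε : ℝ} {k : Fin M} {P Q : Fin M → Setoid (Fin M)}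
    (hw : ∀ j, 0 ≤ w k j) (hσ : ∀ j, 0 ≤ σ k j) (hρ : 0 ≤ ρ) (hε : 0 ≤ ε)
    (hcons : ∀ j ∈ Mi k, w k j * |delta (P k) k j - delta (P j) k j| = 0)
    (h : Refines (P k) (Q k)) :
    Jcost Mi w σ ρ ε k P ≤ Jcost Mi w σ ρ ε k Q := by
  unfold Jcost
  refine add_le_add ?_ (mul_le_mul_of_nonneg_left (Finset.sum_le_sum fun j _ => ?_) hρ)
  · rw [Finset.sum_eq_zero hcons]
    exact Finset.sum_nonneg fun j _ => mul_nonneg (hw j) (abs_nonneg _)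
  · exact mul_le_mul_of_nonneg_left (sub_le_sub_left (delta_le_of_refines h k j) 1)
      (mul_nonneg (add_nonneg (hw j) hε) (hσ j))

/-- **Coarsening case in the proof of Theorem 4.** If the profile `Pe` has zero consensus
cost for every subsystem, then no coarsening deviation can decrease the potential. -/
theorem coarsening_does_not_decrease_potential {M : ℕ} (hM : 1 ≤ M)
    (Mi : Fin M → Finset (Fin M)) (w σ : Fin M → Fin M → ℝ) (ρ ε : ℝ)
    (hMi_irrefl : ∀ i, i ∉ Mi i)
    (hMi_symm : ∀ i j, j ∈ Mi i ↔ i ∈ Mi j)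
    (hw_symm : ∀ i j, w i j = w j i) (hw_nonneg : ∀ i j, 0 ≤ w i j)
    (hσ_symm : ∀ i j, σ i j = σ j i) (hσ_pos : ∀ i j, 0 < σ i j)
    (hρ : 0 < ρ) (hε : 0 ≤ ε)
    (Pe : Fin M → Setoid (Fin M))
    (hcons : ∀ i, ∀ j ∈ Mi i, w i j * |delta (Pe i) i j - delta (Pe j) i j| = 0)
    (i : Fin M) (C : Setoid (Fin M)) (hcoarsen : Refines (Pe i) C) :
    potential Mi w σ ρ ε Pe ≤ potential Mi w σ ρ ε (Function.update Pe i C) := by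
  unfold potential
  refine mul_le_mul_of_nonneg_left (Finset.sum_le_sum fun k _ => ?_) (by norm_num)
  refine Jcost_le_Jcost_of_refines (hw_nonneg k) (fun j => (hσ_pos k j).le) hρ.le hε (hcons k) ?_
  rcases eq_or_ne k i with rfl | hk
  · rwa [Function.update_self]
  · rw [Function.update_of_ne hk]
    exact fun _ _ hab => hab

end ConsensusGame
end

section
/- Consider a switched discrete-time system x(k+1) = f_{σ(k)}(x(k)), where Σ is a finite nonempty set of modes, each f_m : ℝⁿ → ℝⁿ satisfies f_m(0) = 0, and σ : ℕ → Σ is a switching signal. Suppose there exist K-functions α₁, α₂, a constant μ > 0, and continuous functions V_m : ℝⁿ → ℝ (m ∈ Σ) such that α₁(‖x‖) ≤ V_m(x) ≤ α₂(‖x‖) for all x ∈ ℝⁿ and all m ∈ Σ, and such that along every trajectory of the switched system one has V_{σ(k)}(x(k)) ≤ μ · V_{σ(0)}(x(0)) for all k ∈ ℕ. Then the origin is locally stable: for every ε > 0 there exists δ > 0 such that any trajectory with ‖x(0)‖ ≤ δ satisfies ‖x(k)‖ ≤ ε for all k ∈ ℕ. (Lemma 1, multiple Lyapunov-like functions for switched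 systems.) -/
open Filter Set

/-- **Lemma 1 (multiple Lyapunov-like functions for switched systems).**
Consider the switched system `x(k+1) = f_{σ(k)}(x(k))` with a finite nonempty mode set
`S`, `f m 0 = 0`, and a switching signal `σ`. If there are 𝒦-functions `α₁, α₂`
(continuous and strictly increasing on `[0,∞)` with value `0` at `0`), a constant
`μ > 0`, and continuous functions `V m` with
`α₁ ‖x‖ ≤ V m x ≤ α₂ ‖x‖` for all `x` and `m`, such that along every trajectory
`V_{σ(k)}(x(k)) ≤ μ · V_{σ(0)}(x(0))` for all `k`, then the origin is locally stable:
for every `ε > 0` there is `δ > 0` such that every trajectory starting with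
`‖x 0‖ ≤ δ` satisfies `‖x k‖ ≤ ε` for all `k`. -/
theorem switched_system_locally_stable {n : ℕ}
    (S : Type*) [Fintype S] [Nonempty S]
    (f : S → EuclideanSpace ℝ (Fin n) → EuclideanSpace ℝ (Fin n))
    (hf0 : ∀ m : S, f m 0 = 0)
    (σ : ℕ → S)
    (α₁ α₂ : ℝ → ℝ)
    (hα₁cont : ContinuousOn α₁ (Ici 0)) (hα₁mono : StrictMonoOn α₁ (Ici 0))
    (hα₁zero : α₁ 0 = 0)
    (hα₂cont : ContinuousOn α₂ (Ici 0)) (hα₂mono : StrictMonoOn α₂ (Ici 0))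
    (hα₂zero : α₂ 0 = 0)
    (μ : ℝ) (hμ : 0 < μ)
    (V : S → EuclideanSpace ℝ (Fin n) → ℝ)
    (hVcont : ∀ m : S, Continuous (V m))
    (hVlow : ∀ (m : S) (x : EuclideanSpace ℝ (Fin n)), α₁ ‖x‖ ≤ V m x)
    (hVup : ∀ (m : S) (x : EuclideanSpace ℝ (Fin n)), V m x ≤ α₂ ‖x‖)
    (htraj : ∀ x : ℕ → EuclideanSpace ℝ (Fin n),
      (∀ k : ℕ, x (k + 1) = f (σ k) (x k)) →
        ∀ k : ℕ, V (σ k) (x k) ≤ μ * V (σ 0) (x 0)) :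
    ∀ ε > (0 : ℝ), ∃ δ > (0 : ℝ), ∀ x : ℕ → EuclideanSpace ℝ (Fin n),
      (∀ k : ℕ, x (k + 1) = f (σ k) (x k)) → ‖x 0‖ ≤ δ → ∀ k : ℕ, ‖x k‖ ≤ ε := by
  intro ε hε
  have hα₁ε : 0 < α₁ ε := by
    simpa [hα₁zero] using hα₁mono self_mem_Ici hε.le hε
  obtain ⟨δ, hδ, hα₂δ⟩ := Metric.continuousWithinAt_iff.mp (hα₂cont 0 self_mem_Ici)
    (α₁ ε / μ) (div_pos hα₁ε hμ)
  refine ⟨δ / 2, half_pos hδ, fun x hx hx0 k => ?_⟩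
  have hlt : α₂ ‖x 0‖ < α₁ ε / μ := by
    have h := hα₂δ (x := ‖x 0‖) (norm_nonneg _) (by
      rw [Real.dist_eq, sub_zero, abs_of_nonneg (norm_nonneg _)]
      linarith)
    rw [Real.dist_eq, hα₂zero, sub_zero] at h
    exact (le_abs_self _).trans_lt h
  refine (hα₁mono.le_iff_le (norm_nonneg (x k)) hε.le).mp ?_
  calc α₁ ‖x k‖ ≤ V (σ k) (x k) := hVlow _ _
    _ ≤ μ * V (σ 0) (x 0) := htraj x hx k
    _ ≤ μ * α₂ ‖x 0‖ := mul_le_mul_of_nonneg_left (hVup _ _) hμ.le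
    _ ≤ μ * (α₁ ε / μ) := mul_le_mul_of_nonneg_left hlt.le hμ.le
    _ = α₁ ε := mul_div_cancel₀ _ hμ.ne'
end

section
/- Let A ∈ ℝ^{n×n} and B ∈ ℝ^{n×m} be matrices, let X, W′ ⊆ ℝⁿ and U ⊆ ℝ^m be sets, and let R ⊆ ℝⁿ be robust control invariant (RCI) for the system x⁺ = Ax + Bu + w and constraint set (X, U, W′). Let b ∈ (0,1] and let W ⊆ ℝⁿ satisfy W ⊆ b•W′. Then the scaled set b•R is RCI for the system x⁺ = Ax + Bu + w and constraint set (b•X, b•U, W): b•R ⊆ b•X, and for every x ∈ b•R there exists u ∈ b•U such that Ax + Bu + w ∈ b•R for all w ∈ W. (Scaling and disturbance-monotonicity argument used in the proof of Theorem 5, nesting of RCI sets.) -/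
open Pointwise

/-- `R` is robust control invariant (RCI) for the system `x⁺ = Ax + Bu + w` and
constraint set `(X, U, W)`: `R ⊆ X`, and for every `x ∈ R` there is `u ∈ U` with
`Ax + Bu + w ∈ R` for all `w ∈ W`. -/
def IsRCI {n m : ℕ} (A : Matrix (Fin n) (Fin n) ℝ) (B : Matrix (Fin n) (Fin m) ℝ)
    (X : Set (Fin n → ℝ)) (U : Set (Fin m → ℝ)) (W : Set (Fin n → ℝ))
    (R : Set (Fin n → ℝ)) : Prop :=
  R ⊆ X ∧ ∀ x ∈ R, ∃ u ∈ U, ∀ w ∈ W, A.mulVec x + B.mulVec u + w ∈ R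

/-- **Scaling and disturbance monotonicity of RCI sets (used in the proof of Theorem 5).**
If `R` is RCI for `x⁺ = Ax + Bu + w` with constraint set `(X, U, W′)`, `b ∈ (0,1]` and
`W ⊆ b • W′`, then `b • R` is RCI for the same dynamics and constraint set
`(b • X, b • U, W)`. -/
theorem scaled_set_isRCI {n m : ℕ}
    (A : Matrix (Fin n) (Fin n) ℝ) (B : Matrix (Fin n) (Fin m) ℝ)
    (X W' R : Set (Fin n → ℝ)) (U : Set (Fin m → ℝ))
    (hRCI : IsRCI A B X U W' R)
    (b : ℝ) (hb0 : 0 < b) (hb1 : b ≤ 1)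
    (W : Set (Fin n → ℝ)) (hW : W ⊆ b • W') :
    IsRCI A B (b • X) (b • U) W (b • R) := by
  obtain ⟨hRX, hinv⟩ := hRCI
  refine ⟨Set.smul_set_mono hRX, ?_⟩
  rintro _ ⟨x, hx, rfl⟩
  obtain ⟨u, hu, hstep⟩ := hinv x hx
  refine ⟨b • u, Set.smul_mem_smul_set hu, fun w hw => ?_⟩
  obtain ⟨w', hw', rfl⟩ := hW hw
  refine ⟨_, hstep w' hw', ?_⟩
  simp only [smul_add, Matrix.mulVec_smul]
end

section
/- Fix M ≥ 1, for each j ∈ Fin M a dimension n_j and a set X_j ⊆ ℝ^{n_j} with 0 ∈ X_j, and for each pair (i, j) a linear map A_{ij} : ℝ^{n_j} → ℝ^{n_i}. For a coalition c ⊆ Fin M define the coalitional disturbance set W_c ⊆ ∏_{i∈c} ℝ^{n_i} by W_c = { w : ∃ x with x_j ∈ X_j for all j ∉ c, such that w_i = Σ_{j∉c} A_{ij} x_j for each i ∈ c }. Then for any coalitions c′ ⊆ c and any w ∈ W_c, the restriction (w_i)_{i∈c′} belongs to W_{c′}. In particular, if a coalition c is split as a disjoint union c = c′ ∪ c″, the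 set W_c (viewed in ∏_{i∈c′} ℝ^{n_i} × ∏_{i∈c″} ℝ^{n_i}) is contained in W_{c′} × W_{c″}: the disturbance sets grow under partition refinement. (First part of the proof of Theorem 5, nesting of disturbance sets.) -/
open Finset

/-- The disturbance set of a coalition `c ⊆ Fin M`: the set of tuples
`w = (w_i)_{i∈c}` for which there exist states `x_j ∈ X_j` of the subsystems
outside the coalition with `w_i = Σ_{j∉c} A_{ij} x_j` for each `i ∈ c`. -/
def coalDisturbanceSet (M : ℕ) (n : Fin M → ℕ)
    (X : ∀ j : Fin M, Set (Fin (n j) → ℝ))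
    (A : ∀ i j : Fin M, (Fin (n j) → ℝ) →ₗ[ℝ] (Fin (n i) → ℝ))
    (c : Finset (Fin M)) :
    Set (∀ i : {x // x ∈ c}, Fin (n i.1) → ℝ) :=
  { w | ∃ x : ∀ j : Fin M, Fin (n j) → ℝ,
      (∀ j : Fin M, j ∉ c → x j ∈ X j) ∧
      ∀ i : {x // x ∈ c}, w i = ∑ j ∈ cᶜ, A i.1 j (x j) }

/-- **First part of the proof of Theorem 5 (nesting of disturbance sets).**
If `0 ∈ X_j` for all `j`, then for coalitions `c′ ⊆ c` the restriction to `c′` of any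
disturbance in `W_c` lies in `W_{c′}`; in particular, when a coalition is split into two,
its disturbance set is contained in the product of those of the parts: disturbance sets
grow under partition refinement. -/
theorem coalDisturbanceSet_restriction_mem (M : ℕ) (hM : 1 ≤ M) (n : Fin M → ℕ)
    (X : ∀ j : Fin M, Set (Fin (n j) → ℝ)) (hX0 : ∀ j : Fin M, (0 : Fin (n j) → ℝ) ∈ X j)
    (A : ∀ i j : Fin M, (Fin (n j) → ℝ) →ₗ[ℝ] (Fin (n i) → ℝ))
    (c' c : Finset (Fin M)) (hc' : c'.Nonempty) (hc : c.Nonempty) (hsub : c' ⊆ c)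
    (w : ∀ i : {x // x ∈ c}, Fin (n i.1) → ℝ)
    (hw : w ∈ coalDisturbanceSet M n X A c) :
    (fun i : {x // x ∈ c'} => w ⟨i.1, hsub i.2⟩) ∈ coalDisturbanceSet M n X A c' := by
  obtain ⟨x, hx, hwx⟩ := hw
  refine ⟨fun j => if j ∈ c then 0 else x j, fun j _ => ?_, fun i => ?_⟩
  · by_cases h : j ∈ c
    · simpa [h] using hX0 j
    · simpa [h] using hx j h
  · refine (hwx ⟨i.1, hsub i.2⟩).trans ?_
    have hcc : cᶜ ⊆ c'ᶜ := Finset.compl_subset_compl.mpr hsub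
    rw [← Finset.sum_subset hcc]
    · refine Finset.sum_congr rfl fun j hj => ?_
      simp [Finset.mem_compl.mp hj]
    · intro j _ hj
      rw [Finset.mem_compl, not_not] at hj
      simp [hj]
end

section
/- Let A ∈ ℝ^{n×n}, B ∈ ℝ^{n×m}, let X′ ⊆ ℝⁿ and U′ ⊆ ℝ^m with 0 ∈ X′ and 0 ∈ U′, and let N ≥ 1. If x ∈ X̄^N and u is an admissible control sequence for x over horizon N, then the successor state A x + B u(0) also belongs to X̄^N; in particular, the feasibility region X̄^N is positively invariant for the closed-loop dynamics x⁺ = A x + B κ(x), where κ(x) is the first element of any admissible (e.g. optimal) control sequence at x. (Proposition 1(i) and Corollary 1: recursive feasibility of the primary MPC controller with terminal equality constraint.) -/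
/-- A control sequence `u` is admissible for the state `x` over horizon `N`: the states
`x(0) = x`, `x(j+1) = A x(j) + B u(j)` satisfy `x(j) ∈ X'` and `u(j) ∈ U'` for
`j = 0,…,N−1`, and `x(N) = 0`. -/
def Admissible {n m : ℕ} (A : Matrix (Fin n) (Fin n) ℝ) (B : Matrix (Fin n) (Fin m) ℝ)
    (X' : Set (Fin n → ℝ)) (U' : Set (Fin m → ℝ)) (N : ℕ)
    (x : Fin n → ℝ) (u : ℕ → Fin m → ℝ) : Prop :=
  ∃ xs : ℕ → Fin n → ℝ, xs 0 = x ∧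
    (∀ j < N, xs (j + 1) = A.mulVec (xs j) + B.mulVec (u j)) ∧
    (∀ j < N, xs j ∈ X' ∧ u j ∈ U') ∧ xs N = 0

/-- The `N`-step feasibility region `X̄^N`. -/
def Feas {n m : ℕ} (A : Matrix (Fin n) (Fin n) ℝ) (B : Matrix (Fin n) (Fin m) ℝ)
    (X' : Set (Fin n → ℝ)) (U' : Set (Fin m → ℝ)) (N : ℕ) : Set (Fin n → ℝ) :=
  { x | ∃ u : ℕ → Fin m → ℝ, Admissible A B X' U' N x u }

/-- **Proposition 1(i) and Corollary 1 (recursive feasibility of the primary MPC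
controller).** If `0 ∈ X'`, `0 ∈ U'`, `N ≥ 1`, `x ∈ X̄^N` and `u` is an admissible
control sequence for `x`, then the successor state `A x + B u(0)` also lies in `X̄^N`;
in particular `X̄^N` is positively invariant for the closed loop `x⁺ = A x + B κ(x)`
where `κ(x)` is the first element of any admissible control sequence at `x`. -/
theorem successor_mem_feas {n m : ℕ}
    (A : Matrix (Fin n) (Fin n) ℝ) (B : Matrix (Fin n) (Fin m) ℝ)
    (X' : Set (Fin n → ℝ)) (U' : Set (Fin m → ℝ))
    (h0X : (0 : Fin n → ℝ) ∈ X') (h0U : (0 : Fin m → ℝ) ∈ U')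
    (N : ℕ) (hN : 1 ≤ N)
    (x : Fin n → ℝ) (u : ℕ → Fin m → ℝ)
    (hadm : Admissible A B X' U' N x u) :
    A.mulVec x + B.mulVec (u 0) ∈ Feas A B X' U' N := by
  obtain ⟨xs, hx0, hdyn, hmem, hxN⟩ := hadm
  refine ⟨fun j => if j + 1 < N then u (j + 1) else 0,
    fun j => if j < N then xs (j + 1) else 0, ?_, fun j hj => ?_, fun j hj => ?_, by simp⟩
  · simp [Nat.lt_of_lt_of_le Nat.zero_lt_one hN, hdyn 0 hN, hx0]
  · by_cases h : j + 1 < N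
    · simp [h, hj, hdyn (j + 1) h]
    · have hjN : j + 1 = N := by omega
      simp [hjN, hj, hxN]
  · by_cases h : j + 1 < N
    · simpa [h, hj] using hmem (j + 1) h
    · have hjN : j + 1 = N := by omega
      simpa [hjN, hj, hxN] using And.intro h0X h0U
end

section
/- Let A ∈ ℝ^{n×n}, B ∈ ℝ^{n×m}, let X″ ⊆ ℝⁿ and U″ ⊆ ℝ^m with 0 ∈ X″ and 0 ∈ U″, let N ≥ 1 and H ≥ N + 1, and let w̄ : ℕ → ℝⁿ be a disturbance sequence with w̄(j) = 0 for all j ≥ N. Suppose e ∈ Ē^H(w̄) with admissible witness f. Then the successor error A e + B f(0) + w̄(0) belongs to Ē^H(w̄⁺), where w̄⁺ is the shifted disturbance sequence w̄⁺(j) = w̄(j+1). (Proposition 1(ii): recursive feasibility of the secondary MPC controller under the shifted planned-disturbance sequence.) -/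
/-- A control sequence `f` is an admissible witness for the error `e` over horizon `H`
with planned disturbance sequence `wbar`: the errors `e(0) = e`,
`e(j+1) = A e(j) + B f(j) + wbar(j)` satisfy `e(j) ∈ X''` and `f(j) ∈ U''` for
`j = 0,…,H−1`, and `e(H) = 0`. -/
def AdmissibleE {n m : ℕ} (A : Matrix (Fin n) (Fin n) ℝ) (B : Matrix (Fin n) (Fin m) ℝ)
    (X'' : Set (Fin n → ℝ)) (U'' : Set (Fin m → ℝ)) (H : ℕ) (wbar : ℕ → Fin n → ℝ)
    (e : Fin n → ℝ) (f : ℕ → Fin m → ℝ) : Prop :=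
  ∃ es : ℕ → Fin n → ℝ, es 0 = e ∧
    (∀ j < H, es (j + 1) = A.mulVec (es j) + B.mulVec (f j) + wbar j) ∧
    (∀ j < H, es j ∈ X'' ∧ f j ∈ U'') ∧ es H = 0

/-- The `H`-step error feasibility region `Ē^H(w̄)`. -/
def FeasE {n m : ℕ} (A : Matrix (Fin n) (Fin n) ℝ) (B : Matrix (Fin n) (Fin m) ℝ)
    (X'' : Set (Fin n → ℝ)) (U'' : Set (Fin m → ℝ)) (H : ℕ) (wbar : ℕ → Fin n → ℝ) :
    Set (Fin n → ℝ) :=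
  { e | ∃ f : ℕ → Fin m → ℝ, AdmissibleE A B X'' U'' H wbar e f }

/-- **Proposition 1(ii): recursive feasibility of the secondary MPC controller.**
If `0 ∈ X''`, `0 ∈ U''`, `N ≥ 1`, `H ≥ N + 1`, the planned disturbance sequence `w̄`
vanishes from step `N` on, and `e ∈ Ē^H(w̄)` with admissible witness `f`, then the
successor error `A e + B f(0) + w̄(0)` lies in `Ē^H(w̄⁺)` for the shifted disturbance
sequence `w̄⁺(j) = w̄(j+1)`. -/
theorem successor_error_mem_feasE {n m : ℕ}
    (A : Matrix (Fin n) (Fin n) ℝ) (B : Matrix (Fin n) (Fin m) ℝ)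
    (X'' : Set (Fin n → ℝ)) (U'' : Set (Fin m → ℝ))
    (h0X : (0 : Fin n → ℝ) ∈ X'') (h0U : (0 : Fin m → ℝ) ∈ U'')
    (N H : ℕ) (hN : 1 ≤ N) (hH : N + 1 ≤ H)
    (wbar : ℕ → Fin n → ℝ) (hw : ∀ j : ℕ, N ≤ j → wbar j = 0)
    (e : Fin n → ℝ) (f : ℕ → Fin m → ℝ)
    (hadm : AdmissibleE A B X'' U'' H wbar e f) :
    A.mulVec e + B.mulVec (f 0) + wbar 0 ∈
      FeasE A B X'' U'' H (fun j => wbar (j + 1)) := by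
  obtain ⟨es, rfl, hstep, hcon, hend⟩ := hadm
  refine ⟨fun j => if j + 1 < H then f (j + 1) else 0,
    fun j => if j + 1 < H then es (j + 1) else 0, ?_, fun j hj => ?_, fun j hj => ?_, ?_⟩
  · have h1 : 0 + 1 < H := by omega
    simp only [if_pos h1]
    exact hstep 0 (by omega)
  · by_cases h : j + 1 < H
    · by_cases h2 : j + 1 + 1 < H
      · simpa only [if_pos h, if_pos h2] using hstep (j + 1) h
      · have hlast : j + 1 + 1 = H := by omega
        have key := hstep (j + 1) h
        rw [hlast, hend] at key
        simpa only [if_pos h, if_neg h2] using key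
    · have h2 : ¬ j + 1 + 1 < H := by omega
      simp [h, h2, hw (j + 1) (by omega)]
  · by_cases h : j + 1 < H
    · simpa only [if_pos h] using hcon (j + 1) h
    · simpa only [if_neg h] using And.intro h0X h0U
  · simp
end
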